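/- arXiv:1607.06747 — 2 statements merged into one kernel-verified Lean document; each statement's English description precedes it below -/
import Mathlib

section
/- Let A, B be bounded operators on a complex Hilbert space with AB = λBA ≠ 0, λ ∈ ℂ. If A is hyponormal and 0 is an isolated point of the spectrum of A, and B is quasi *-paranormal, then |λ| = 1. -/
open Filter Topology in
/-- If `A` satisfies a resolvent estimate `‖(z - A)⁻¹‖ ≤ 1 / ‖z‖` on a punctured disc around `0`,
then `A` is invertible relative to a bounded operator commuting with it. -/
theorem exists_commuting_relative_inverse {R : Type*} [NormedRing R] [NormedAlgebra ℂ R]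
    [CompleteSpace R] (A : R) {δ : ℝ} (hδ : 0 < δ)
    (hres : ∀ z : ℂ, z ≠ 0 → ‖z‖ < δ → z ∈ resolventSet ℂ A)
    (hbound : ∀ z : ℂ, z ≠ 0 → ‖z‖ < δ → ‖resolvent A z‖ ≤ 1 / ‖z‖) :
    ∃ T : R, A * T = T * A ∧ A * A * T = A := by
  set f : ℂ → R := fun z => z • resolvent A z with hf
  set g : ℂ → R := Function.update f 0 (limUnder (𝓝[≠] 0) f) with hg
  have hball : Metric.ball (0 : ℂ) δ ∈ 𝓝 (0 : ℂ) := Metric.ball_mem_nhds 0 hδ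
  have hdiff : DifferentiableOn ℂ f (Metric.ball 0 δ \ {0}) := fun z hz =>
    (differentiableAt_id.smul (spectrum.hasDerivAt_resolvent_const_left
      (hres z hz.2 (by simpa using hz.1))).differentiableAt).differentiableWithinAt
  have hbdd : BddAbove (norm ∘ f '' (Metric.ball 0 δ \ {0})) := by
    refine ⟨1, ?_⟩
    rintro _ ⟨z, ⟨hz, hz0⟩, rfl⟩
    have hz0 : z ≠ 0 := hz0
    have hpos : 0 < ‖z‖ := norm_pos_iff.2 hz0
    calc ‖z • resolvent A z‖ ≤ ‖z‖ * ‖resolvent A z‖ := norm_smul_le _ _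
      _ ≤ ‖z‖ * (1 / ‖z‖) := by gcongr; exact hbound z hz0 (by simpa using hz)
      _ = 1 := by field_simp
  have hgd : HasDerivAt g (deriv g 0) 0 :=
    ((Complex.differentiableOn_update_limUnder_of_bddAbove hball hdiff hbdd).differentiableAt
      hball).hasDerivAt
  have hlin : HasDerivAt (fun z : ℂ => algebraMap ℂ R z - A) 1 0 := by
    simpa [Algebra.algebraMap_eq_smul_one] using
      ((hasDerivAt_id (0 : ℂ)).smul_const (1 : R)).sub_const A
  have halg : HasDerivAt (fun z : ℂ => algebraMap ℂ R z) 1 0 := by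
    simpa [Algebra.algebraMap_eq_smul_one] using (hasDerivAt_id (0 : ℂ)).smul_const (1 : R)
  have hpunct : ∀ᶠ z in 𝓝[≠] (0 : ℂ), (algebraMap ℂ R z - A) * g z = algebraMap ℂ R z ∧
      g z * (algebraMap ℂ R z - A) = algebraMap ℂ R z := by
    filter_upwards [self_mem_nhdsWithin, nhdsWithin_le_nhds hball] with z hz hzb
    have hz : z ≠ 0 := hz
    have hu : IsUnit (algebraMap ℂ R z - A) := hres z hz (by simpa using hzb)
    rw [hg, Function.update_of_ne hz]
    simp only [hf, resolvent, mul_smul_comm, smul_mul_assoc, Ring.mul_inverse_cancel _ hu,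
      Ring.inverse_mul_cancel _ hu, ← Algebra.algebraMap_eq_smul_one, and_self]
  have hleft := hlin.mul hgd
  have hright := hgd.mul hlin
  have extend : ∀ h : ℂ → R, ContinuousAt h 0 → (∀ᶠ z in 𝓝[≠] (0 : ℂ), h z = algebraMap ℂ R z) →
      h =ᶠ[𝓝 0] fun z => algebraMap ℂ R z := fun h hc he =>
    (hc.eventuallyEq_nhds_iff_eventuallyEq_nhdsNE halg.continuousAt).1 he
  have eleft := extend _ hleft.continuousAt (hpunct.mono fun z hz => hz.1)
  have eright := extend _ hright.continuousAt (hpunct.mono fun z hz => hz.2)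
  have dleft := (halg.congr_of_eventuallyEq eleft).unique hleft
  have dright := (halg.congr_of_eventuallyEq eright).unique hright
  have hzero := eleft.self_of_nhds
  simp only [map_zero, zero_sub, Pi.mul_apply, neg_mul, mul_neg, one_mul, mul_one, neg_eq_zero]
    at dleft dright hzero
  have hg0 : g 0 = 1 + A * deriv g 0 := by rw [dleft]; abel
  refine ⟨-deriv g 0, ?_, ?_⟩
  · have : g 0 + -(A * deriv g 0) = g 0 + -(deriv g 0 * A) := by
      rw [← dleft, dright]; abel
    simpa using this
  · rw [hg0, mul_add, mul_one, ← mul_assoc] at hzero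
    rw [mul_neg]
    exact (eq_neg_of_add_eq_zero_left hzero).symm

section Hyponormal

variable {H : Type*} [NormedAddCommGroup H] [InnerProductSpace ℂ H] [CompleteSpace H]

open ContinuousLinearMap

/-- Translates of hyponormal operators are hyponormal. -/
theorem hyponormal_algebraMap_sub {A : H →L[ℂ] H} (hA : ∀ x, ‖adjoint A x‖ ≤ ‖A x‖) (z : ℂ)
    (x : H) : ‖adjoint (algebraMap ℂ (H →L[ℂ] H) z - A) x‖
      ≤ ‖(algebraMap ℂ (H →L[ℂ] H) z - A) x‖ := by
  have e1 : (algebraMap ℂ (H →L[ℂ] H) z - A) x = z • x - A x := by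
    simp [Algebra.algebraMap_eq_smul_one]
  have e2 : adjoint (algebraMap ℂ (H →L[ℂ] H) z - A) x
      = (starRingEnd ℂ z) • x - adjoint A x := by
    refine ext_inner_right ℂ fun y => ?_
    simp [Algebra.algebraMap_eq_smul_one, adjoint_inner_left, inner_sub_left,
      inner_smul_left, inner_smul_right]
  have e3 : RCLike.re (inner ℂ ((starRingEnd ℂ z) • x) (adjoint A x))
      = RCLike.re (inner ℂ (z • x) (A x)) := by
    rw [inner_smul_left, inner_smul_left, adjoint_inner_right, ← inner_conj_symm (A x) x,
      ← RCLike.conj_re, map_mul, RCLike.conj_conj, RCLike.conj_conj]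
  rw [e1, e2]
  refine le_of_sq_le_sq ?_ (norm_nonneg _)
  rw [@norm_sub_sq ℂ, @norm_sub_sq ℂ, e3, norm_smul, norm_smul, RCLike.norm_conj]
  have := pow_le_pow_left₀ (norm_nonneg _) (hA x) 2
  linarith

/-- A right inverse of a hyponormal operator is hyponormal. -/
theorem hyponormal_inverse {T S : H →L[ℂ] H} (hT : ∀ x, ‖adjoint T x‖ ≤ ‖T x‖)
    (hTS : T * S = 1) (x : H) : ‖adjoint S x‖ ≤ ‖S x‖ := by
  have hTS' : ∀ y, T (S y) = y := fun y => by simpa using DFunLike.congr_fun hTS y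
  have hC : ‖adjoint T * S‖ ≤ 1 := opNorm_le_bound _ zero_le_one fun y => by
    simpa [hTS'] using hT (S y)
  have hC' : ‖adjoint S * T‖ ≤ 1 := by
    rw [← LinearIsometryEquiv.norm_map adjoint (adjoint S * T)]
    rwa [show adjoint (adjoint S * T) = adjoint T * S from by
      simpa [star_eq_adjoint] using star_mul (star S) T]
  have := (adjoint S * T).le_of_opNorm_le hC' (S x)
  simpa [hTS'] using this

theorem hyponormal_norm_pow_mul_le {T : H →L[ℂ] H} (hT : ∀ x, ‖adjoint T x‖ ≤ ‖T x‖) (n : ℕ) :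
    ‖T ^ n‖ * ‖T‖ ≤ ‖T ^ (n + 1)‖ := by
  induction n with
  | zero =>
    have : ‖(1 : H →L[ℂ] H)‖ ≤ 1 := norm_id_le
    simpa using mul_le_mul_of_nonneg_right this (norm_nonneg T)
  | succ n ih =>
    have key : ‖T ^ (n + 1)‖ ^ 2 ≤ ‖T ^ (n + 2)‖ * ‖T ^ n‖ := by
      have hsqrt : ‖T ^ (n + 1)‖ ≤ √(‖T ^ (n + 2)‖ * ‖T ^ n‖) := by
        refine opNorm_le_bound _ (Real.sqrt_nonneg _) fun x => ?_
        refine le_of_sq_le_sq ?_ (by positivity)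
        rw [mul_pow, Real.sq_sqrt (by positivity)]
        have h1 : (T ^ (n + 1)) x = T ((T ^ n) x) := by rw [pow_succ']; rfl
        have h2 : (T ^ (n + 2)) x = T ((T ^ (n + 1)) x) := by rw [pow_succ' T (n + 1)]; rfl
        calc ‖(T ^ (n + 1)) x‖ ^ 2
            = RCLike.re (inner ℂ (adjoint T ((T ^ (n + 1)) x)) ((T ^ n) x)) := by
              rw [adjoint_inner_left, ← h1, inner_self_eq_norm_sq]
          _ ≤ ‖adjoint T ((T ^ (n + 1)) x)‖ * ‖(T ^ n) x‖ := re_inner_le_norm _ _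
          _ ≤ ‖(T ^ (n + 2)) x‖ * ‖(T ^ n) x‖ := by
              rw [h2]; gcongr; exact hT _
          _ ≤ (‖T ^ (n + 2)‖ * ‖x‖) * (‖T ^ n‖ * ‖x‖) := by
              gcongr <;> exact le_opNorm _ _
          _ = ‖T ^ (n + 2)‖ * ‖T ^ n‖ * ‖x‖ ^ 2 := by ring
      calc _ ≤ √(‖T ^ (n + 2)‖ * ‖T ^ n‖) ^ 2 := by gcongr
        _ = _ := Real.sq_sqrt (by positivity)
    rcases (norm_nonneg (T ^ n)).eq_or_lt with h | h
    · have : T ^ (n + 1) = 0 := by rw [pow_succ, norm_eq_zero.1 h.symm, zero_mul]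
      simp [this]
    · refine le_of_mul_le_mul_right ?_ h
      calc ‖T ^ (n + 1)‖ * ‖T‖ * ‖T ^ n‖ = ‖T ^ (n + 1)‖ * (‖T ^ n‖ * ‖T‖) := by ring
        _ ≤ ‖T ^ (n + 1)‖ * ‖T ^ (n + 1)‖ := by gcongr
        _ ≤ _ := by rw [← sq]; exact key

/-- Hyponormal operators are normaloid. -/
theorem hyponormal_nnnorm_le_spectralRadius {T : H →L[ℂ] H}
    (hT : ∀ x, ‖adjoint T x‖ ≤ ‖T x‖) : (‖T‖₊ : ENNReal) ≤ spectralRadius ℂ T := by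
  have hpow : ∀ n : ℕ, ‖T‖ ^ (n + 1) ≤ ‖T ^ (n + 1)‖ := fun n => by
    induction n with
    | zero => simp
    | succ n ih =>
      calc ‖T‖ ^ (n + 2) = ‖T‖ ^ (n + 1) * ‖T‖ := pow_succ _ _
        _ ≤ ‖T ^ (n + 1)‖ * ‖T‖ := by gcongr
        _ ≤ _ := hyponormal_norm_pow_mul_le hT _
  refine ge_of_tendsto (spectrum.pow_nnnorm_pow_one_div_tendsto_nhds_spectralRadius T) ?_
  filter_upwards [Filter.eventually_gt_atTop 0] with n hn
  obtain ⟨m, rfl⟩ := Nat.exists_eq_succ_of_ne_zero hn.ne'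
  rw [one_div, ENNReal.le_rpow_inv_iff (by positivity), ENNReal.rpow_natCast]
  exact_mod_cast hpow m

/-- The resolvent of a hyponormal operator whose nonzero spectrum stays away from `0`. -/
theorem hyponormal_norm_resolvent_le {A : H →L[ℂ] H} (hA : ∀ x, ‖adjoint A x‖ ≤ ‖A x‖) {ε : ℝ}
    (hiso : ∀ w ∈ spectrum ℂ A, w ≠ 0 → ε ≤ ‖w‖) {z : ℂ} (hz0 : z ≠ 0) (hz : ‖z‖ < ε / 2) :
    ‖resolvent A z‖ ≤ 1 / ‖z‖ := by
  have hpos : 0 < ‖z‖ := norm_pos_iff.2 hz0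
  have hmem : z ∈ resolventSet ℂ A := by
    by_contra h
    linarith [hiso z h hz0]
  obtain ⟨u, hu⟩ : IsUnit (algebraMap ℂ (H →L[ℂ] H) z - A) := hmem
  have hR : resolvent A z = ↑u⁻¹ := by rw [resolvent, ← hu, Ring.inverse_unit]
  have hhyp : ∀ x, ‖adjoint (resolvent A z) x‖ ≤ ‖resolvent A z x‖ :=
    hyponormal_inverse (T := (u : H →L[ℂ] H)) (by rw [hu]; exact hyponormal_algebraMap_sub hA z)
      (by rw [hR, Units.mul_inv])
  have hrad : spectralRadius ℂ (resolvent A z) ≤ ((1 / ‖z‖₊ : NNReal) : ENNReal) := by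
    refine iSup₂_le fun k hk => ?_
    rw [ENNReal.coe_le_coe]
    rw [hR] at hk
    have hk0 : k ≠ 0 := spectrum.ne_zero_of_mem_of_unit hk
    have hkinv : k⁻¹ ∈ spectrum ℂ (algebraMap ℂ (H →L[ℂ] H) z - A) := by
      rw [← hu]
      have := (spectrum.inv_mem_iff (r := Units.mk0 k hk0) (a := u⁻¹)).1 hk
      simpa using this
    have hw : z - k⁻¹ ∈ spectrum ℂ A := by
      rw [← spectrum.singleton_sub_eq] at hkinv
      obtain ⟨a, ha, w, hw, e⟩ := Set.mem_sub.1 hkinv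
      rw [Set.mem_singleton_iff] at ha
      rw [← e, ha, sub_sub_cancel]
      exact hw
    have hle : ‖z‖ ≤ ‖k⁻¹‖ := by
      by_cases h : z - k⁻¹ = 0
      · rw [sub_eq_zero.1 h]
      · have h1 := hiso _ hw h
        have h2 := norm_sub_le z k⁻¹
        linarith
    rw [← NNReal.coe_le_coe]
    rw [norm_inv] at hle
    have := inv_anti₀ hpos hle
    simpa using this
  have := (hyponormal_nnnorm_le_spectralRadius hhyp).trans hrad
  exact_mod_cast this

/-- A quasi *-paranormal operator has `ker (B ^ n) = ker B` for `n ≥ 1`. -/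
theorem quasi_star_paranormal_apply_eq_zero {B : H →L[ℂ] H}
    (hB : ∀ x, ‖adjoint B (B x)‖ ^ 2 ≤ ‖(B ^ 3) x‖ * ‖B x‖) (n : ℕ) {x : H}
    (hx : (B ^ (n + 1)) x = 0) : B x = 0 := by
  have h3 : ∀ y, (B ^ 3) y = 0 → B y = 0 := fun y hy => by
    have h := hB y
    rw [hy, norm_zero, zero_mul] at h
    have h0 : adjoint B (B y) = 0 := by
      rw [← norm_eq_zero]
      exact pow_eq_zero_iff two_ne_zero |>.1 (le_antisymm h (by positivity))
    rw [← inner_self_eq_zero (𝕜 := ℂ), ← adjoint_inner_left, h0, inner_zero_left]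
  induction n with
  | zero => simpa using hx
  | succ n ih =>
    rcases n with _ | n
    · refine h3 x ?_
      rw [pow_succ']
      change B ((B ^ (0 + 1 + 1)) x) = 0
      rw [hx, map_zero]
    · have e1 : (B ^ (n + 1 + 1 + 1)) x = (B ^ 3) ((B ^ n) x) := by
        rw [show n + 1 + 1 + 1 = 3 + n by ring, pow_add]; rfl
      have h : (B ^ (n + 1)) x = 0 := by
        rw [pow_succ']
        exact h3 _ (e1 ▸ hx)
      refine ih ?_
      rw [pow_succ']
      change B ((B ^ (n + 1)) x) = 0
      rw [h, map_zero]

end Hyponormal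

theorem mul_pow_of_smul_comm {R : Type*} [Ring R] [Algebra ℂ R] {A B : R} {c : ℂ}
    (h : A * B = c • (B * A)) (n : ℕ) : A * B ^ n = c ^ n • (B ^ n * A) := by
  induction n with
  | zero => simp
  | succ n ih =>
    rw [pow_succ, ← mul_assoc, ih, smul_mul_assoc, mul_assoc, h, mul_smul_comm, smul_smul,
      pow_succ, mul_assoc]

theorem exists_pow_mul_eq_zero_of_smul_comm {R : Type*} [NormedRing R] [NormedAlgebra ℂ R]
    {A B T : R} {c : ℂ} (h : A * B = c • (B * A)) (hc0 : c ≠ 0) (hc : ‖c‖ ≠ 1)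
    (hAT : A * T = T * A) (hAAT : A * A * T = A) : ∃ n : ℕ, B ^ (n + 1) * A = 0 := by
  have hTAA : T * A * A = A := by rw [← hAT, mul_assoc, ← hAT, ← mul_assoc, hAAT]
  set K : ℝ := ‖A‖ * ‖T‖ with hK
  by_contra! hne
  have hpos : ∀ n : ℕ, 0 < ‖B ^ (n + 1) * A‖ := fun n => norm_pos_iff.2 (hne n)
  have upper : ∀ n : ℕ, ‖c‖ ^ (n + 1) ≤ K := fun n => by
    refine le_of_mul_le_mul_right ?_ (hpos n)
    have e : c ^ (n + 1) • (B ^ (n + 1) * A) = A * (B ^ (n + 1) * A) * T := by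
      rw [← mul_assoc A, mul_pow_of_smul_comm h, smul_mul_assoc, smul_mul_assoc, mul_assoc,
        mul_assoc, ← mul_assoc A, hAAT]
    calc ‖c‖ ^ (n + 1) * ‖B ^ (n + 1) * A‖ = ‖A * (B ^ (n + 1) * A) * T‖ := by
          rw [← e, norm_smul, norm_pow]
      _ ≤ ‖A‖ * ‖B ^ (n + 1) * A‖ * ‖T‖ := norm_mul₃_le
      _ = K * ‖B ^ (n + 1) * A‖ := by rw [hK]; ring
  have lower : ∀ n : ℕ, 1 ≤ ‖c‖ ^ (n + 1) * K := fun n => by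
    refine le_of_mul_le_mul_right ?_ (hpos n)
    have hcn : c ^ (n + 1) ≠ 0 := pow_ne_zero _ hc0
    have e : B ^ (n + 1) * A = c ^ (n + 1) • (T * (B ^ (n + 1) * A) * A) := by
      have e1 : A * B ^ (n + 1) = T * A * (A * B ^ (n + 1)) := by rw [← mul_assoc, hTAA]
      rw [mul_pow_of_smul_comm h, mul_smul_comm] at e1
      refine (smul_right_injective _ hcn e1).trans ?_
      rw [mul_assoc T A, ← mul_assoc A, mul_pow_of_smul_comm h,
        smul_mul_assoc, mul_smul_comm, mul_assoc T]
    calc 1 * ‖B ^ (n + 1) * A‖ = ‖c ^ (n + 1) • (T * (B ^ (n + 1) * A) * A)‖ := by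
          rw [← e, one_mul]
      _ = ‖c‖ ^ (n + 1) * ‖T * (B ^ (n + 1) * A) * A‖ := by rw [norm_smul, norm_pow]
      _ ≤ ‖c‖ ^ (n + 1) * (‖T‖ * ‖B ^ (n + 1) * A‖ * ‖A‖) := by gcongr; exact norm_mul₃_le
      _ = ‖c‖ ^ (n + 1) * K * ‖B ^ (n + 1) * A‖ := by rw [hK]; ring
  rcases hc.lt_or_gt with hlt | hgt
  · have ht := ((tendsto_pow_atTop_nhds_zero_of_lt_one (norm_nonneg c) hlt).comp
      (Filter.tendsto_add_atTop_nat 1)).mul_const K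
    rw [zero_mul] at ht
    exact absurd (ge_of_tendsto' ht lower) (by norm_num)
  · obtain ⟨n, hn⟩ := pow_unbounded_of_one_lt K hgt
    have := pow_le_pow_right₀ hgt.le (show n ≤ n + 1 by lia)
    linarith [upper n]

theorem lambda_commute_hyponormal_isolated_zero
    {H : Type*} [NormedAddCommGroup H] [InnerProductSpace ℂ H] [CompleteSpace H]
    (A B : H →L[ℂ] H) (lam : ℂ)
    (hcomm : A * B = lam • (B * A)) (hne : A * B ≠ 0)
    (hA : ∀ x : H, ‖(ContinuousLinearMap.adjoint A) x‖ ≤ ‖A x‖)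
    (h0 : (0 : ℂ) ∈ spectrum ℂ A)
    (hiso : ∃ ε > (0 : ℝ), ∀ z ∈ spectrum ℂ A, z ≠ 0 → ε ≤ ‖z‖)
    (hB : ∀ x : H, ‖(ContinuousLinearMap.adjoint B) (B x)‖ ^ 2 ≤ ‖(B ^ 3) x‖ * ‖B x‖) :
    ‖lam‖ = 1 := by
  obtain ⟨ε, hε, hiso⟩ := hiso
  obtain ⟨T, hAT, hAAT⟩ := exists_commuting_relative_inverse A (half_pos hε)
    (fun z hz0 hz => by
      by_contra h
      linarith [hiso z h hz0])
    (fun z hz0 hz => hyponormal_norm_resolvent_le hA hiso hz0 hz)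
  by_contra hlam
  have hlam0 : lam ≠ 0 := fun h => hne (by rw [hcomm, h, zero_smul])
  obtain ⟨n, hn⟩ := exists_pow_mul_eq_zero_of_smul_comm hcomm hlam0 hlam hAT hAAT
  refine hne ?_
  rw [hcomm, show B * A = 0 from ?_, smul_zero]
  ext x
  exact quasi_star_paranormal_apply_eq_zero hB n (by simpa using DFunLike.congr_fun hn x)
end

section
/- Let A be binormal ((A*A)(AA*) = (AA*)(A*A)) and B be normal, with AB = λBA ≠ 0 for λ ∈ ℂ with |λ| = 1. Then AB is binormal: ((AB)*(AB))((AB)(AB)*) = ((AB)(AB)*)((AB)*(AB)). -/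
/-- If `b` is normal, `a` is binormal and `a * b = lam • (b * a)` with `lam` unimodular, then
`a * b` is binormal. -/
theorem binormal_mul_of_mul_eq_smul {R : Type*} [CStarAlgebra R] {a b : R} {lam : ℂ}
    (ha : Commute (star a * a) (a * star a)) (hb : IsStarNormal b)
    (hab : a * b = lam • (b * a)) (hlam : ‖lam‖ = 1) :
    Commute (star (a * b) * (a * b)) (a * b * star (a * b)) := by
  have hsemi : SemiconjBy a b (lam • b) := by rw [SemiconjBy, hab, smul_mul_assoc]
  have hsmul : IsStarNormal (lam • b) :=
    ⟨by simpa using ((hb.star_comm_self.smul_left (star lam)).smul_right lam)⟩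
  have hstar : SemiconjBy a (star b) (star (lam • b)) := hsemi.star_right hb hsmul
  have hnorm : star (lam • b) * (lam • b) = star b * b := by
    have hunit : star lam * lam = 1 := by
      simpa [hlam] using RCLike.conj_mul lam
    rw [star_smul, smul_mul_smul_comm, hunit, one_smul]
  have hN : Commute a (star b * b) := by
    exact hnorm ▸ hstar.mul_right hsemi
  have hN' : Commute (star a) (star b * b) := by
    simpa only [star_mul, star_star] using hN.star_star
  have hback : SemiconjBy (star a) (lam • b) b := by
    simpa only [SemiconjBy, star_mul, star_star] using (congrArg star hstar.eq).symm
  have hP : Commute (star a * a) b := hback.mul_left hsemi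
  have hleft : star (a * b) * (a * b) = (star b * b) * (star a * a) := by
    rw [star_mul, mul_assoc (star b), ← mul_assoc (star a), hP.eq, ← mul_assoc]
  have hright : a * b * star (a * b) = (star b * b) * (a * star a) := by
    rw [star_mul, mul_assoc, ← mul_assoc b, ← hb.star_comm_self.eq, ← mul_assoc, hN.eq, mul_assoc]
  rw [hleft, hright]
  exact ((Commute.refl _).mul_right (hN.mul_left hN').symm).mul_left
    ((hN'.mul_left hN).mul_right ha)

theorem lambda_commute_binormal_mul
    {H : Type*} [NormedAddCommGroup H] [InnerProductSpace ℂ H] [CompleteSpace H]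
    (A B : H →L[ℂ] H) (lam : ℂ)
    (hA : (ContinuousLinearMap.adjoint A * A) * (A * ContinuousLinearMap.adjoint A) =
          (A * ContinuousLinearMap.adjoint A) * (ContinuousLinearMap.adjoint A * A))
    (hB : ContinuousLinearMap.adjoint B * B = B * ContinuousLinearMap.adjoint B)
    (hcomm : A * B = lam • (B * A)) (hne : A * B ≠ 0) (hlam : ‖lam‖ = 1) :
    (ContinuousLinearMap.adjoint (A * B) * (A * B)) *
        ((A * B) * ContinuousLinearMap.adjoint (A * B)) =
      ((A * B) * ContinuousLinearMap.adjoint (A * B)) *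
        (ContinuousLinearMap.adjoint (A * B) * (A * B)) := by
  have h := binormal_mul_of_mul_eq_smul (show Commute (star A * A) (A * star A) from hA) ⟨hB⟩
    hcomm hlam
  exact h.eq
end
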